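/- arXiv:2406.11144 — 2 statements merged into one kernel-verified Lean document; each statement's English description precedes it below -/
import Mathlib

section
/- Let N ≥ 1 and let f_1, …, f_N : ℝⁿ → ℝ be twice differentiable with f(x) := (1/N) ∑_{i=1}^N f_i(x). Fix x ∈ ℝⁿ and constants κ₂, μ₂, κ_H > 0 such that ‖∇²f_i(x)‖ ≤ κ₂ + μ₂ ‖∇²f(x)‖ for every i ∈ {1,…,N} and ‖∇²f(x)‖ ≤ κ_H, where ‖·‖ denotes the operator (spectral) norm of the Hessian matrix. Then for every nonempty subset S ⊆ {1,…,N}, one has ‖∇²f(x) − (1/|S|) ∑_{i∈S} ∇²f_i(x)‖ ≤ 2 ((N − |S|)/N) (κ₂ + μ₂ κ_H). -/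
open Finset

/-- The mean of a finite family of vectors of norm at most `C` differs from the mean over a
nonempty subfamily by at most `2 C` times the proportion of omitted indices. -/
theorem norm_mean_sub_mean_subset_le {ι E : Type*} [Fintype ι] [NormedAddCommGroup E]
    [NormedSpace ℝ E] (H : ι → E) {C : ℝ} (hH : ∀ i, ‖H i‖ ≤ C)
    (S : Finset ι) (hS : S.Nonempty) :
    ‖(1 / (Fintype.card ι : ℝ)) • ∑ i, H i - (1 / (S.card : ℝ)) • ∑ i ∈ S, H i‖ ≤
      2 * (((Fintype.card ι : ℝ) - S.card) / Fintype.card ι) * C := by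
  classical
  have hs : (0 : ℝ) < S.card := by exact_mod_cast hS.card_pos
  have hle : (S.card : ℝ) ≤ Fintype.card ι := by exact_mod_cast S.card_le_univ
  have hcompl : ((Sᶜ.card : ℕ) : ℝ) = Fintype.card ι - S.card := by
    rw [Finset.card_compl, Nat.cast_sub S.card_le_univ]
  have norm_sum (T : Finset ι) : ‖∑ i ∈ T, H i‖ ≤ T.card * C := by
    simpa using norm_sum_le_of_le T fun i _ => hH i
  rw [← Finset.sum_add_sum_compl S H]
  set N : ℝ := (Fintype.card ι : ℝ)
  set s : ℝ := (S.card : ℝ)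
  have hN : 0 < N := hs.trans_le hle
  have hd : 0 ≤ N - s := sub_nonneg.2 hle
  have hcoeff : 1 / N - 1 / s = -((N - s) / (N * s)) := by field_simp; ring
  calc
    _ = ‖(1 / N) • ∑ i ∈ Sᶜ, H i - ((N - s) / (N * s)) • ∑ i ∈ S, H i‖ := by
      congr 1
      rw [smul_add, sub_eq_add_neg _ (((N - s) / (N * s)) • _), ← neg_smul, ← hcoeff, sub_smul]
      abel
    _ ≤ 1 / N * ‖∑ i ∈ Sᶜ, H i‖ + (N - s) / (N * s) * ‖∑ i ∈ S, H i‖ := by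
      refine (norm_sub_le _ _).trans_eq ?_
      rw [norm_smul_of_nonneg (by positivity), norm_smul_of_nonneg (by positivity)]
    _ ≤ 1 / N * ((N - s) * C) + (N - s) / (N * s) * (s * C) := by
      gcongr
      · exact hcompl ▸ norm_sum Sᶜ
      · exact norm_sum S
    _ = _ := by field_simp; ring

/-- The second derivative of a scaled finite sum is the scaled sum of the second derivatives. -/
theorem fderiv_fderiv_const_mul_sum {ι E : Type*} [Fintype ι] [NormedAddCommGroup E]
    [NormedSpace ℝ E] {f : ι → E → ℝ} (hf : ∀ i, Differentiable ℝ (f i))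
    (hf' : ∀ i, Differentiable ℝ (fderiv ℝ (f i))) (c : ℝ) (x : E) :
    fderiv ℝ (fderiv ℝ fun z => c * ∑ i, f i z) x = c • ∑ i, fderiv ℝ (fderiv ℝ (f i)) x := by
  have h : fderiv ℝ (fun z => c * ∑ i, f i z) = fun z => c • ∑ i, fderiv ℝ (f i) z := by
    ext1 z
    exact ((HasFDerivAt.fun_sum fun i _ => (hf i z).hasFDerivAt).const_mul c).fderiv
  rw [h]
  exact ((HasFDerivAt.fun_sum fun i _ => (hf' i x).hasFDerivAt).const_smul c).fderiv

theorem stmt_2 (n N : ℕ) (hN : 1 ≤ N)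
    (fi : Fin N → EuclideanSpace ℝ (Fin n) → ℝ)
    (hdiff : ∀ i, Differentiable ℝ (fi i))
    (hdiff2 : ∀ i, Differentiable ℝ (fderiv ℝ (fi i)))
    (f : EuclideanSpace ℝ (Fin n) → ℝ)
    (hf : ∀ z, f z = (1 / (N : ℝ)) * ∑ i, fi i z)
    (x : EuclideanSpace ℝ (Fin n)) (κ₂ μ₂ κH : ℝ)
    (hκ₂ : 0 < κ₂) (hμ₂ : 0 < μ₂) (hκH : 0 < κH)
    (hbound : ∀ i, ‖fderiv ℝ (fderiv ℝ (fi i)) x‖ ≤ κ₂ + μ₂ * ‖fderiv ℝ (fderiv ℝ f) x‖)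
    (hHb : ‖fderiv ℝ (fderiv ℝ f) x‖ ≤ κH)
    (S : Finset (Fin N)) (hS : S.Nonempty) :
    ‖fderiv ℝ (fderiv ℝ f) x - (1 / (S.card : ℝ)) • ∑ i ∈ S, fderiv ℝ (fderiv ℝ (fi i)) x‖ ≤
      2 * (((N : ℝ) - (S.card : ℝ)) / (N : ℝ)) * (κ₂ + μ₂ * κH) := by
  obtain rfl : f = fun z => (1 / (N : ℝ)) * ∑ i, fi i z := funext hf
  have hC : ∀ i, ‖fderiv ℝ (fderiv ℝ (fi i)) x‖ ≤ κ₂ + μ₂ * κH := fun i =>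
    (hbound i).trans (by gcongr)
  rw [fderiv_fderiv_const_mul_sum hdiff hdiff2]
  simpa only [Fintype.card_fin] using
    norm_mean_sub_mean_subset_le (fun i => fderiv ℝ (fderiv ℝ (fi i)) x) hC S hS
end

section
/- Let f : ℝⁿ → ℝ be differentiable with ∇f Lipschitz with constant L₁, and c = (c_1,…,c_m) : ℝⁿ → ℝᵐ differentiable with each ∇c_i Lipschitz with constant Γ_{1,i}, Γ₁ := ∑_i Γ_{1,i}. Let τ > 0, η ∈ (0,1), κ_l > 0, and x, d ∈ ℝⁿ with ∇c(x)ᵀ d = −c(x). Let ḡ ∈ ℝⁿ and set Δl := −τ ḡᵀd + ‖c(x)‖₁, and assume Δl ≥ κ_l τ ‖d‖². Let f̄ : ℝⁿ → ℝ and ε_f, ε_A ≥ 0 satisfy |f̄(x) − f(x)| ≤ ε_f, |f̄(x + α d) − f(x + α d)| ≤ ε_f, and ε_A ≥ τ ‖∇f(x) − ḡ‖ ‖d‖ + 2 τ ε_f. Then for every α with 0 < α ≤ min{1, 2 τ κ_l (1 − η)/(τ L₁ + Γ₁)}, the relaxed Armijo condition holds: τ f̄(x + α d) + ‖c(x + α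 d)‖₁ ≤ τ f̄(x) + ‖c(x)‖₁ − η α Δl + ε_A. -/
open Finset RealInnerProductSpace

/-- Second-order Taylor bound for a differentiable function with Lipschitz derivative. -/
theorem norm_sub_sub_fderiv_le_of_lipschitz {E F : Type*} [NormedAddCommGroup E]
    [NormedSpace ℝ E] [NormedAddCommGroup F] [NormedSpace ℝ F] {g : E → F}
    (hg : Differentiable ℝ g) {L : ℝ}
    (hL : ∀ a b, ‖fderiv ℝ g a - fderiv ℝ g b‖ ≤ L * ‖a - b‖) (x v : E) :
    ‖g (x + v) - g x - fderiv ℝ g x v‖ ≤ L / 2 * ‖v‖ ^ 2 := by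
  have hderiv : ∀ t : ℝ, HasDerivAt (fun t : ℝ => g (x + t • v) - g x - t • fderiv ℝ g x v)
      (fderiv ℝ g (x + t • v) v - fderiv ℝ g x v) t := by
    intro t
    have hline : HasDerivAt (fun t : ℝ => x + t • v) v t := by
      simpa using ((hasDerivAt_id t).smul_const v).const_add x
    have hlin : HasDerivAt (fun t : ℝ => t • fderiv ℝ g x v) (fderiv ℝ g x v) t := by
      simpa using (hasDerivAt_id t).smul_const (fderiv ℝ g x v)
    exact (((hg (x + t • v)).hasFDerivAt.comp_hasDerivAt t hline).sub_const (g x)).sub hlin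
  have hbound : ∀ t : ℝ, HasDerivAt (fun t : ℝ => L / 2 * ‖v‖ ^ 2 * t ^ 2)
      (L * ‖v‖ ^ 2 * t) t := by
    intro t
    refine ((hasDerivAt_pow 2 t).const_mul (L / 2 * ‖v‖ ^ 2)).congr_deriv ?_
    norm_num
    ring
  have key := image_norm_le_of_norm_deriv_right_le_deriv_boundary (a := 0) (b := 1)
    (fun t _ => (hderiv t).continuousAt.continuousWithinAt)
    (fun t _ => (hderiv t).hasDerivWithinAt) (by simp) hbound
    (fun t ht => by
      rw [← sub_apply]
      calc _ ≤ ‖fderiv ℝ g (x + t • v) - fderiv ℝ g x‖ * ‖v‖ := ContinuousLinearMap.le_opNorm _ _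
        _ ≤ L * ‖x + t • v - x‖ * ‖v‖ := by gcongr; exact hL _ _
        _ = L * ‖v‖ ^ 2 * t := by
          rw [add_sub_cancel_left, norm_smul, Real.norm_of_nonneg ht.1]
          ring)
    (Set.right_mem_Icc.2 zero_le_one)
  simpa using key

theorem stmt_10 (n m : ℕ)
    (f : EuclideanSpace ℝ (Fin n) → ℝ) (hfd : Differentiable ℝ f)
    (L₁ : ℝ) (hfLip : ∀ a b, ‖gradient f a - gradient f b‖ ≤ L₁ * ‖a - b‖)
    (c : Fin m → EuclideanSpace ℝ (Fin n) → ℝ) (hcd : ∀ i, Differentiable ℝ (c i))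
    (Γ₁i : Fin m → ℝ)
    (hcLip : ∀ i, ∀ a b, ‖fderiv ℝ (c i) a - fderiv ℝ (c i) b‖ ≤ Γ₁i i * ‖a - b‖)
    (τ η κl : ℝ) (hτ : 0 < τ) (hη : η ∈ Set.Ioo (0 : ℝ) 1) (hκl : 0 < κl)
    (x d : EuclideanSpace ℝ (Fin n))
    (hlin : ∀ i, fderiv ℝ (c i) x d = -(c i x))
    (gbar : EuclideanSpace ℝ (Fin n))
    (Δl : ℝ) (hΔl : Δl = -(τ * ⟪gbar, d⟫) + ∑ i, |c i x|)
    (hΔllb : κl * τ * ‖d‖ ^ 2 ≤ Δl)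
    (fbar : EuclideanSpace ℝ (Fin n) → ℝ) (εf εA : ℝ) (hεf : 0 ≤ εf) (hεA0 : 0 ≤ εA)
    (hfbar0 : |fbar x - f x| ≤ εf)
    (hεAge : τ * ‖gradient f x - gbar‖ * ‖d‖ + 2 * τ * εf ≤ εA) :
    ∀ α : ℝ, 0 < α →
      α ≤ min 1 (2 * τ * κl * (1 - η) / (τ * L₁ + ∑ i, Γ₁i i)) →
      |fbar (x + α • d) - f (x + α • d)| ≤ εf →
      τ * fbar (x + α • d) + ∑ i, |c i (x + α • d)| ≤
        τ * fbar x + ∑ i, |c i x| - η * α * Δl + εA := by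
  intro α hα hαle hfbar1
  obtain ⟨hη0, hη1⟩ := hη
  obtain ⟨hα1, hα2⟩ := le_min_iff.1 hαle
  have hstep : α * (τ * L₁ + ∑ i, Γ₁i i) ≤ 2 * τ * κl * (1 - η) := by
    have hnum : 0 < 2 * τ * κl * (1 - η) := by
      have := sub_pos.2 hη1
      positivity
    have hden : 0 < τ * L₁ + ∑ i, Γ₁i i :=
      (div_pos_iff_of_pos_left hnum).1 (hα.trans_le hα2)
    exact (le_div_iff₀ hden).1 hα2
  have hnorm : ‖α • d‖ ^ 2 = α ^ 2 * ‖d‖ ^ 2 := by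
    rw [norm_smul, mul_pow, Real.norm_eq_abs, sq_abs]
  have hf : f (x + α • d) ≤ f x + α * ⟪gradient f x, d⟫ + L₁ / 2 * (α ^ 2 * ‖d‖ ^ 2) := by
    have hLip : ∀ a b, ‖fderiv ℝ f a - fderiv ℝ f b‖ ≤ L₁ * ‖a - b‖ := by
      intro a b
      have h := hfLip a b
      rwa [gradient, gradient, ← map_sub, LinearIsometryEquiv.norm_map] at h
    have hgrad : fderiv ℝ f x d = ⟪gradient f x, d⟫ := by
      rw [gradient, InnerProductSpace.toDual_symm_apply]
    have h := norm_sub_sub_fderiv_le_of_lipschitz hfd hLip x (α • d)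
    rw [hnorm, map_smul, smul_eq_mul, hgrad, Real.norm_eq_abs] at h
    linarith [(abs_le.1 h).2]
  have hc : ∑ i, |c i (x + α • d)| ≤
      (1 - α) * ∑ i, |c i x| + (∑ i, Γ₁i i) / 2 * (α ^ 2 * ‖d‖ ^ 2) := by
    rw [Finset.mul_sum, Finset.sum_div, Finset.sum_mul, ← Finset.sum_add_distrib]
    refine Finset.sum_le_sum fun i _ => ?_
    have h := norm_sub_sub_fderiv_le_of_lipschitz (hcd i) (hcLip i) x (α • d)
    rw [hnorm, map_smul, smul_eq_mul, hlin i, Real.norm_eq_abs] at h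
    calc |c i (x + α • d)|
        = |(1 - α) * c i x + (c i (x + α • d) - c i x - α * -c i x)| := by congr 1; ring
      _ ≤ |(1 - α) * c i x| + |c i (x + α • d) - c i x - α * -c i x| := abs_add_le _ _
      _ ≤ (1 - α) * |c i x| + Γ₁i i / 2 * (α ^ 2 * ‖d‖ ^ 2) := by
        rw [abs_mul, abs_of_nonneg (sub_nonneg.2 hα1)]
        gcongr
  have herr : α * τ * (⟪gradient f x, d⟫ - ⟪gbar, d⟫) ≤ τ * ‖gradient f x - gbar‖ * ‖d‖ := by
    rw [← inner_sub_left]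
    calc α * τ * ⟪gradient f x - gbar, d⟫
        ≤ α * τ * (‖gradient f x - gbar‖ * ‖d‖) := by gcongr; exact real_inner_le_norm _ _
      _ ≤ 1 * τ * (‖gradient f x - gbar‖ * ‖d‖) := by gcongr
      _ = τ * ‖gradient f x - gbar‖ * ‖d‖ := by ring
  have hquad : (τ * L₁ + ∑ i, Γ₁i i) / 2 * (α ^ 2 * ‖d‖ ^ 2) ≤ α * (1 - η) * Δl := by
    calc (τ * L₁ + ∑ i, Γ₁i i) / 2 * (α ^ 2 * ‖d‖ ^ 2)
        = α * (τ * L₁ + ∑ i, Γ₁i i) * (α * ‖d‖ ^ 2 / 2) := by ring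
      _ ≤ 2 * τ * κl * (1 - η) * (α * ‖d‖ ^ 2 / 2) := by gcongr
      _ = α * (1 - η) * (κl * τ * ‖d‖ ^ 2) := by ring
      _ ≤ α * (1 - η) * Δl :=
        mul_le_mul_of_nonneg_left hΔllb (mul_nonneg hα.le (sub_nonneg.2 hη1.le))
  have hτf := mul_le_mul_of_nonneg_left hf hτ.le
  have hτ0 := mul_le_mul_of_nonneg_left (abs_le.1 hfbar0).1 hτ.le
  have hτ1 := mul_le_mul_of_nonneg_left (abs_le.1 hfbar1).2 hτ.le
  have hαΔ : α * Δl = α * (-(τ * ⟪gbar, d⟫) + ∑ i, |c i x|) := by rw [hΔl]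
  linarith
end
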